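/- Base case of the induction lemma: Let U be a finite type and f : Finset U → ℝ be monotone and submodular. Let P^1, P^2, G^1, G^2 ⊆ U satisfy f(P^1) ≥ f(G^1) and f(P^2 | P^1) ≥ f(G^2 | P^1). Then f(P^1 ∪ P^2) ≥ f(G^1 ∪ G^2) + f(P^1 | G^1 ∪ G^2) − f(P^1 | G^1). -/

import Mathlib

/-- A set function is submodular if
`f (A ∪ {e}) - f A ≥ f (B ∪ {e}) - f B` for all `A ⊆ B` and `e ∉ B`. -/
def IsSubmodular {U : Type*} [DecidableEq U] (f : Finset U → ℝ) : Prop :=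
  ∀ A B : Finset U, A ⊆ B → ∀ e ∉ B, f (insert e A) - f A ≥ f (insert e B) - f B

/-- A set function is monotone if `f A ≤ f B` whenever `A ⊆ B`. -/
def IsMonotoneFn {U : Type*} [DecidableEq U] (f : Finset U → ℝ) : Prop :=
  ∀ A B : Finset U, A ⊆ B → f A ≤ f B

/-- The marginal gain `f(A | B) = f (A ∪ B) - f B`. -/
def marg {U : Type*} [DecidableEq U] (f : Finset U → ℝ) (A B : Finset U) : ℝ :=
  f (A ∪ B) - f B

/-- Diminishing returns: marginal gains of a monotone submodular function are antitone in the
base set. -/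
theorem IsSubmodular.marg_anti {U : Type*} [DecidableEq U] {f : Finset U → ℝ}
    (hsub : IsSubmodular f) (hmono : IsMonotoneFn f) {A B : Finset U} (hAB : A ⊆ B)
    (C : Finset U) : marg f C B ≤ marg f C A := by
  unfold marg
  induction C using Finset.induction_on with
  | empty => simp
  | insert e C _ ih =>
    rw [Finset.insert_union, Finset.insert_union]
    by_cases he : e ∈ C ∪ B
    · rw [Finset.insert_eq_of_mem he]
      linarith [hmono _ _ (Finset.subset_insert e (C ∪ A))]
    · linarith [hsub (C ∪ A) (C ∪ B) (Finset.union_subset_union_right hAB) e he]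

/-- Base case of the induction lemma: if `f P¹ ≥ f G¹` and
`f(P² | P¹) ≥ f(G² | P¹)`, then
`f (P¹ ∪ P²) ≥ f (G¹ ∪ G²) + f(P¹ | G¹ ∪ G²) - f(P¹ | G¹)`. -/
theorem induction_base_case {U : Type*} [Fintype U] [DecidableEq U]
    (f : Finset U → ℝ) (hmono : IsMonotoneFn f) (hsub : IsSubmodular f)
    (P1 P2 G1 G2 : Finset U)
    (h1 : f P1 ≥ f G1) (h2 : marg f P2 P1 ≥ marg f G2 P1) :
    f (P1 ∪ P2) ≥ f (G1 ∪ G2) + marg f P1 (G1 ∪ G2) - marg f P1 G1 := by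
  have hanti := hsub.marg_anti hmono (Finset.subset_union_left : P1 ⊆ P1 ∪ G1) G2
  have hunion : G2 ∪ (P1 ∪ G1) = P1 ∪ (G1 ∪ G2) := by
    rw [Finset.union_comm, Finset.union_assoc]
  unfold marg at *
  rw [hunion] at hanti
  rw [Finset.union_comm P2 P1] at h2
  linarith
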